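/- Let X be a normal space such that every one-point subset of X is Gδ. Then the socle of B₁(X) equals the intersection of all free ideals of B₁(X). -/

import Mathlib

open Filter Topology

def IsBaireOne {X : Type*} [TopologicalSpace X] (f : X → ℝ) : Prop :=
  ∃ F : ℕ → X → ℝ, (∀ n, Continuous (F n)) ∧
    ∀ x, Filter.Tendsto (fun n => F n x) Filter.atTop (nhds (f x))

def B1 (X : Type*) [TopologicalSpace X] : Subring (X → ℝ) where
  carrier := {f | IsBaireOne f}
  zero_mem' := ⟨fun _ _ => 0, fun _ => continuous_const, fun _ => tendsto_const_nhds⟩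
  one_mem' := ⟨fun _ _ => 1, fun _ => continuous_const, fun _ => tendsto_const_nhds⟩
  add_mem' := by
    rintro f g ⟨F, hF, hFf⟩ ⟨G, hG, hGg⟩
    exact ⟨fun n => F n + G n, fun n => (hF n).add (hG n), fun x => (hFf x).add (hGg x)⟩
  mul_mem' := by
    rintro f g ⟨F, hF, hFf⟩ ⟨G, hG, hGg⟩
    exact ⟨fun n => F n * G n, fun n => (hF n).mul (hG n), fun x => (hFf x).mul (hGg x)⟩
  neg_mem' := by
    rintro f ⟨F, hF, hFf⟩
    exact ⟨fun n => -F n, fun n => (hF n).neg, fun x => (hFf x).neg⟩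

def zset {X : Type*} [TopologicalSpace X] (f : ↥(B1 X)) : Set X := {x | (f : X → ℝ) x = 0}

noncomputable def chi {X : Type*} (p : X) : X → ℝ := Set.indicator {p} (fun _ => 1)

def IsFsigma {X : Type*} [TopologicalSpace X] (s : Set X) : Prop :=
  ∃ c : ℕ → Set X, (∀ n, IsClosed (c n)) ∧ s = ⋃ n, c n


theorem chi_baire {X : Type*} [TopologicalSpace X] [T1Space X] [NormalSpace X]
    (p : X) (hG : IsGδ ({p} : Set X)) : IsBaireOne (chi p) := by
  obtain ⟨U, hU, hpU⟩ := isGδ_iff_eq_iInter_nat.1 hG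
  have hp : ∀ n, p ∈ U n := by
    have h : p ∈ ⋂ n, U n := hpU ▸ Set.mem_singleton p
    exact Set.mem_iInter.1 h
  have key : ∀ n : ℕ, ∃ f : X → ℝ, Continuous f ∧ f p = 1 ∧
      ∀ m ≤ n, ∀ x, x ∉ U m → f x = 0 := by
    intro n
    have hV : IsOpen (⋂ m ∈ Set.Iic n, U m) :=
      (Set.finite_Iic n).isOpen_biInter fun i _ => hU i
    obtain ⟨f, h0, h1, -⟩ := exists_continuous_zero_one_of_isClosed
      (isClosed_compl_iff.2 hV) (isClosed_singleton (x := p))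
      (by
        rw [Set.disjoint_singleton_right]
        simp [hp])
    refine ⟨f, f.continuous, h1 rfl, fun m hm x hx => h0 ?_⟩
    intro hx'
    exact hx (Set.mem_iInter₂.1 hx' m hm)
  choose F hc h1 h0 using key
  refine ⟨F, hc, fun x => ?_⟩
  by_cases hx : x = p
  · subst hx
    simp [chi, h1]
  · have : x ∉ ⋂ n, U n := by rw [← hpU]; exact hx
    obtain ⟨m, hm⟩ : ∃ m, x ∉ U m := by simpa using this
    have hz : chi p x = 0 := by simp [chi, hx]
    rw [hz]
    refine tendsto_const_nhds.congr' ?_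
    filter_upwards [eventually_ge_atTop m] with n hn
    exact (h0 n m hn x hm).symm

theorem chi_mem_of {X : Type*} [TopologicalSpace X] (p : X) (hc : chi p ∈ B1 X)
    (J : Ideal ↥(B1 X)) (g : ↥(B1 X)) (hg : g ∈ J) (hgp : (g : X → ℝ) p ≠ 0) :
    (⟨chi p, hc⟩ : ↥(B1 X)) ∈ J := by
  have hk : (fun _ : X => ((g : X → ℝ) p)⁻¹) ∈ B1 X :=
    ⟨fun _ _ => _, fun _ => continuous_const, fun _ => tendsto_const_nhds⟩
  have e : (⟨chi p, hc⟩ : ↥(B1 X)) = (⟨_, hk⟩ * ⟨chi p, hc⟩) * g := by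
    apply Subtype.ext
    funext x
    by_cases hx : x = p
    · subst hx
      simp [chi, hgp]
    · simp [chi, hx]
  rw [e]
  exact J.mul_mem_left _ hg

theorem exists_ne_of {X : Type*} [TopologicalSpace X] (J : Ideal ↥(B1 X)) (hJ : J ≠ ⊥) :
    ∃ g ∈ J, ∃ p, (g : X → ℝ) p ≠ 0 := by
  obtain ⟨g, hg, hg0⟩ := Submodule.exists_mem_ne_zero_of_ne_bot hJ
  refine ⟨g, hg, ?_⟩
  by_contra! h
  exact hg0 (Subtype.ext (funext h))

theorem chi_atom {X : Type*} [TopologicalSpace X] (p : X) (hc : chi p ∈ B1 X) :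
    IsAtom (Ideal.span {(⟨chi p, hc⟩ : ↥(B1 X))}) := by
  constructor
  · rw [Ne, Ideal.span_singleton_eq_bot]
    intro h
    have := congrFun (congrArg Subtype.val h) p
    simp [chi] at this
  · intro J hJ
    by_contra hb
    obtain ⟨g, hg, q, hq⟩ := exists_ne_of J hb
    obtain ⟨a, ha⟩ := Ideal.mem_span_singleton'.1 (hJ.le hg)
    have hqp : q = p := by
      by_contra hne
      apply hq
      rw [← ha]
      simp [chi, hne]
    subst hqp
    apply hJ.not_ge
    rw [Ideal.span_singleton_le_iff_mem]
    exact chi_mem_of q hc J g hg hq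

theorem stmt_6 {X : Type*} [TopologicalSpace X] [T1Space X] [NormalSpace X]
    (hG : ∀ p : X, IsGδ ({p} : Set X)) :
    (sSup {J : Ideal ↥(B1 X) | IsAtom J}) = sInf {I : Ideal ↥(B1 X) | (⋂ f ∈ I, zset f) = ∅} := by
  have hc : ∀ p : X, chi p ∈ B1 X := fun p => chi_baire p (hG p)
  apply le_antisymm
  · refine sSup_le fun J hJ => le_sInf fun I hI => ?_
    obtain ⟨g, hg, p, hp⟩ := exists_ne_of J hJ.1
    have hle : Ideal.span {(⟨chi p, hc p⟩ : ↥(B1 X))} ≤ J := by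
      rw [Ideal.span_singleton_le_iff_mem]
      exact chi_mem_of p (hc p) J g hg hp
    rcases hJ.le_iff.1 hle with h | h
    · exact absurd h (chi_atom p (hc p)).1
    · rw [← h, Ideal.span_singleton_le_iff_mem]
      have hpI : p ∉ ⋂ f ∈ I, zset f := by
        rw [show (⋂ f ∈ I, zset f) = ∅ from hI]
        exact Set.notMem_empty p
      rw [Set.mem_iInter₂] at hpI
      push Not at hpI
      obtain ⟨f, hf, hfp⟩ := hpI
      exact chi_mem_of p (hc p) I f hf hfp
  · apply sInf_le
    refine Set.eq_empty_of_forall_notMem fun p hp => ?_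
    have h1 : (⟨chi p, hc p⟩ : ↥(B1 X)) ∈ sSup {J : Ideal ↥(B1 X) | IsAtom J} :=
      le_sSup (a := Ideal.span {(⟨chi p, hc p⟩ : ↥(B1 X))}) (chi_atom p (hc p))
        (Ideal.mem_span_singleton_self _)
    have h2 := Set.mem_iInter₂.1 hp _ h1
    simp [zset, chi] at h2
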